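/- For all integers k, p ≥ 2, n ≥ k+2 and all positive integers a₂ ≤ a₃ ≤ ⋯ ≤ a_p, the Ramsey number satisfies r(K_p(1,a₂,…,a_p), B_{k,n}) ≥ (p−1)·(⌊(n−k−1)/a₂⌋ + k)·a₂ + 1, and consequently r(K_p(1,a₂,…,a_p), B_{k,n}) ≥ (p−1)(n−1) + (p−1)(k−1)(a₂−1) + 1. (In particular, taking a₂ ≥ 2 and (k,p) ≠ (2,2), this exceeds (p−1)(n−1) + (a₂−1) + 1, so the book B_{k,n} is not K_p(1,a₂,…,a_p)-good.) -/

import Mathlib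

open SimpleGraph

/-- `G` contains a copy of `H` (as a subgraph, i.e. there is an injective graph homomorphism). -/
def HasCopy {V W : Type*} (G : SimpleGraph V) (H : SimpleGraph W) : Prop :=
  ∃ f : H →g G, Function.Injective f

/-- The Ramsey number `r(H₁, H₂)`: the smallest `N` such that every graph `G` on `N` vertices
contains `H₁` as a subgraph or its complement contains `H₂` as a subgraph. -/
noncomputable def ramseyNumber {V W : Type*} (H₁ : SimpleGraph V) (H₂ : SimpleGraph W) : ℕ :=
  sInf {N : ℕ | ∀ G : SimpleGraph (Fin N), HasCopy G H₁ ∨ HasCopy Gᶜ H₂}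

/-- The complete multipartite graph `K_p(a₁,…,a_p)` with parts of sizes `a 0, …, a (p-1)`. -/
def KMulti {p : ℕ} (a : Fin p → ℕ) : SimpleGraph (Σ i : Fin p, Fin (a i)) :=
  completeMultipartiteGraph fun i => Fin (a i)

/-- The book graph `B_{k,n}`: the join of `K_k` with an independent set of `n - k` vertices,
realized as the complete multipartite graph with `k` parts of size `1` and one part of
size `n - k`. -/
def Book (k n : ℕ) : SimpleGraph (Σ i : Fin (k + 1), Fin (if (i : ℕ) < k then 1 else n - k)) :=
  completeMultipartiteGraph fun i : Fin (k + 1) => Fin (if (i : ℕ) < k then 1 else n - k)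

/-- Finite Ramsey theorem: sufficiently large vertex sets contain a clique of size `s` or an
independent set of size `t`. -/
theorem exists_ramsey_bound (s t : ℕ) :
    ∃ N : ℕ, ∀ (α : Type) (G : SimpleGraph α) (S : Finset α), N ≤ S.card →
      (∃ T ⊆ S, G.IsNClique s T) ∨ ∃ T ⊆ S, Gᶜ.IsNClique t T := by
  classical
  induction s generalizing t with
  | zero => exact ⟨0, fun α G S _ => .inl ⟨∅, by simp, by simp [isNClique_iff]⟩⟩
  | succ s ihs =>
    induction t with
    | zero => exact ⟨0, fun α G S _ => .inr ⟨∅, by simp, by simp [isNClique_iff]⟩⟩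
    | succ t iht =>
      obtain ⟨N₁, h₁⟩ := ihs (t + 1)
      obtain ⟨N₂, h₂⟩ := iht
      refine ⟨N₁ + N₂ + 1, fun α G S hS => ?_⟩
      obtain ⟨v, hv⟩ : S.Nonempty := Finset.card_pos.mp (by omega)
      have hcard := Finset.card_filter_add_card_filter_not (s := S.erase v) (G.Adj v)
      rw [Finset.card_erase_of_mem hv] at hcard
      have hsub (P : α → Prop) [DecidablePred P] : (S.erase v).filter P ⊆ S :=
        (Finset.filter_subset _ _).trans (Finset.erase_subset _ _)
      by_cases hN : N₁ ≤ ((S.erase v).filter (G.Adj v)).card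
      · rcases h₁ α G _ hN with ⟨T, hT, hc⟩ | ⟨T, hT, hc⟩
        · refine .inl ⟨insert v T, Finset.insert_subset hv (hT.trans (hsub _)), hc.insert ?_⟩
          exact fun b hb => (Finset.mem_filter.mp (hT hb)).2
        · exact .inr ⟨T, hT.trans (hsub _), hc⟩
      · rcases h₂ α G ((S.erase v).filter fun w => ¬ G.Adj v w) (by omega) with
          ⟨T, hT, hc⟩ | ⟨T, hT, hc⟩
        · exact .inl ⟨T, hT.trans (hsub _), hc⟩
        · refine .inr ⟨insert v T, Finset.insert_subset hv (hT.trans (hsub _)), hc.insert ?_⟩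
          intro b hb
          have hb' := Finset.mem_filter.mp (hT hb)
          exact (compl_adj _ _ _).mpr ⟨(Finset.ne_of_mem_erase hb'.1).symm, hb'.2⟩

/-- A clique on `|W|` vertices contains a copy of every graph on `W`. -/
theorem HasCopy.of_isNClique {V W : Type*} [Fintype W] {G : SimpleGraph V} (H : SimpleGraph W)
    {T : Finset V} (hT : G.IsNClique (Fintype.card W) T) : HasCopy G H := by
  have e : W ≃ T := Fintype.equivOfCardEq (by simp [hT.card_eq])
  have hinj : Function.Injective fun w => (e w : V) := Subtype.val_injective.comp e.injective
  exact ⟨⟨fun w => e w, fun {u v} huv =>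
    hT.isClique (e u).2 (e v).2 (hinj.ne huv.ne)⟩, hinj⟩

theorem ramseyNumber_set_nonempty {V W : Type*} [Fintype V] [Fintype W]
    (H₁ : SimpleGraph V) (H₂ : SimpleGraph W) :
    {N : ℕ | ∀ G : SimpleGraph (Fin N), HasCopy G H₁ ∨ HasCopy Gᶜ H₂}.Nonempty := by
  obtain ⟨N, hN⟩ := exists_ramsey_bound (Fintype.card V) (Fintype.card W)
  refine ⟨N, fun G => ?_⟩
  rcases hN _ G Finset.univ (by simp) with ⟨T, -, hT⟩ | ⟨T, -, hT⟩
  · exact .inl (.of_isNClique H₁ hT)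
  · exact .inr (.of_isNClique H₂ hT)

/-- A graph avoiding `H₁` whose complement avoids `H₂` gives a lower bound on the Ramsey number. -/
theorem card_lt_ramseyNumber {U V W : Type*} [Fintype U] [Fintype V] [Fintype W]
    {H₁ : SimpleGraph V} {H₂ : SimpleGraph W} (G : SimpleGraph U)
    (h₁ : ¬ HasCopy G H₁) (h₂ : ¬ HasCopy Gᶜ H₂) :
    Fintype.card U < ramseyNumber H₁ H₂ := by
  by_contra! hle
  have hmem := Nat.sInf_mem (ramseyNumber_set_nonempty H₁ H₂)
  change ∀ G : SimpleGraph (Fin (ramseyNumber H₁ H₂)), _ at hmem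
  let e : Fin (ramseyNumber H₁ H₂) ↪ U :=
    (Fin.castLEEmb hle).trans (Fintype.equivFin U).symm.toEmbedding
  rcases hmem (G.comap e) with ⟨f, hf⟩ | ⟨f, hf⟩
  · exact h₁ ⟨⟨fun v => e (f v), fun h => f.map_rel h⟩, e.injective.comp hf⟩
  · refine h₂ ⟨⟨fun v => e (f v), fun {u v} h => ?_⟩, e.injective.comp hf⟩
    have := (compl_adj _ _ _).mp (f.map_rel h)
    exact (compl_adj _ _ _).mpr ⟨e.injective.ne this.1, this.2⟩

/-- The join of `q` copies of the disjoint union of `m` complete graphs `K_s`. -/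
def joinCliqueUnion (q m s : ℕ) : SimpleGraph (Fin q × Fin m × Fin s) where
  Adj u v := u ≠ v ∧ (u.1 = v.1 → u.2.1 = v.2.1)
  symm := ⟨fun _ _ h => ⟨h.1.symm, fun e => (h.2 e.symm).symm⟩⟩
  loopless := ⟨fun _ h => h.1 rfl⟩

theorem not_hasCopy_joinCliqueUnion {q m s : ℕ} (hs : 1 ≤ s) (a : Fin (q + 1) → ℕ)
    (h0 : 1 ≤ a 0) (ha : ∀ i, i ≠ 0 → s ≤ a i) :
    ¬ HasCopy (joinCliqueUnion q m s) (KMulti a) := by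
  classical
  rintro ⟨f, hf⟩
  have hadj {u v : Σ i, Fin (a i)} (h : u.1 ≠ v.1) (hc : (f u).1 = (f v).1) :
      (f u).2.1 = (f v).2.1 :=
    (f.map_rel (show (KMulti a).Adj u v from h)).2 hc
  -- the copies of the clique union that meet at most one part
  let X : Finset (Fin q) :=
    {c | ∀ u v : Σ i, Fin (a i), (f u).1 = c → (f v).1 = c → u.1 = v.1}
  -- the parts that avoid all copies in `X`
  let R : Finset (Fin (q + 1)) := {i | ∀ t : Fin (a i), (f ⟨i, t⟩).1 ∉ X}
  have hRX : Rᶜ.card ≤ X.card := by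
    have hex : ∀ i : Fin (q + 1), i ∈ Rᶜ → ∃ t : Fin (a i), (f ⟨i, t⟩).1 ∈ X := by
      intro i hi
      simpa [R] using hi
    choose t ht using hex
    have key : ∀ i (hi : i ∈ Rᶜ) j (hj : j ∈ Rᶜ),
        (f ⟨i, t i hi⟩).1 = (f ⟨j, t j hj⟩).1 → i = j := by
      intro i hi j hj h
      exact (Finset.mem_filter.mp (ht i hi)).2 ⟨i, t i hi⟩ ⟨j, t j hj⟩ rfl h.symm
    rw [← Finset.card_attach]
    exact Finset.card_le_card_of_injOn (fun i => (f ⟨i.1, t i.1 i.2⟩).1)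
      (fun i _ => ht i.1 i.2) (fun i _ j _ h => Subtype.ext (key _ _ _ _ h))
  have hupper : ∑ i ∈ R, a i ≤ s * Xᶜ.card := by
    have hsum : ∑ i ∈ R, a i = (R.sigma fun i => (Finset.univ : Finset (Fin (a i)))).card := by
      simp
    rw [hsum]
    refine Finset.card_le_mul_card_image_of_maps_to (f := fun u => (f u).1) ?_ s ?_
    · rintro ⟨i, t⟩ hu
      have hi : i ∈ R := (Finset.mem_sigma.mp hu).1
      exact Finset.mem_compl.mpr ((Finset.mem_filter.mp hi).2 t)
    · intro c hc
      have hc' : ∃ u v : Σ i, Fin (a i), (f u).1 = c ∧ (f v).1 = c ∧ u.1 ≠ v.1 := by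
        by_contra! hcon
        exact Finset.mem_compl.mp hc (Finset.mem_filter.mpr ⟨Finset.mem_univ _, hcon⟩)
      obtain ⟨u, v, hu, hv, huv⟩ := hc'
      have hblock : ∀ w, (f w).1 = c → (f w).2.1 = (f u).2.1 := by
        intro w hw
        by_cases hwu : w.1 = u.1
        · rw [hadj (v := v) (hwu ▸ huv) (hw.trans hv.symm), hadj huv (hu.trans hv.symm)]
        · exact hadj hwu (hw.trans hu.symm)
      refine (Finset.card_le_card_of_injOn (t := Finset.univ) (fun w => (f w).2.2)
        (fun _ _ => Finset.mem_univ _) ?_).trans_eq (by simp)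
      intro w hw w' hw' h
      have h₁ := (Finset.mem_filter.mp hw).2
      have h₂ := (Finset.mem_filter.mp hw').2
      exact hf (Prod.ext (h₁.trans h₂.symm)
        (Prod.ext ((hblock w h₁).trans (hblock w' h₂).symm) h))
  have hX : X.card + Xᶜ.card = q := by simp
  have hR : R.card + Rᶜ.card = q + 1 := by simp
  have hlower : s * Xᶜ.card + 1 ≤ ∑ i ∈ R, a i := by
    by_cases h : (0 : Fin (q + 1)) ∈ R
    · rw [← Finset.add_sum_erase _ _ h]
      have hle : (R.erase 0).card • s ≤ ∑ i ∈ R.erase 0, a i :=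
        Finset.card_nsmul_le_sum _ _ _ fun i hi => ha i (Finset.ne_of_mem_erase hi)
      rw [Finset.card_erase_of_mem h, smul_eq_mul, mul_comm] at hle
      have := Nat.mul_le_mul_left s (show Xᶜ.card ≤ R.card - 1 by omega)
      omega
    · have hle : R.card • s ≤ ∑ i ∈ R, a i :=
        Finset.card_nsmul_le_sum _ _ _ fun i hi => ha i fun e => h (e ▸ hi)
      rw [smul_eq_mul, mul_comm] at hle
      have := Nat.mul_le_mul_left s (show Xᶜ.card + 1 ≤ R.card by omega)
      rw [mul_add] at this
      omega
  omega

theorem not_hasCopy_compl_joinCliqueUnion {q m s k n : ℕ} (hk : 1 ≤ k)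
    (hm : (m - k) * s < n - k) :
    ¬ HasCopy (joinCliqueUnion q m s)ᶜ (Book k n) := by
  classical
  rintro ⟨f, hf⟩
  have hadj {u v} (h : (Book k n).Adj u v) : (f u).1 = (f v).1 ∧ (f u).2.1 ≠ (f v).2.1 := by
    have h' := (compl_adj _ _ _).mp (f.map_rel h)
    have hnot : ¬ (f u ≠ f v ∧ ((f u).1 = (f v).1 → (f u).2.1 = (f v).2.1)) := h'.2
    tauto
  let x (i : Fin k) : Σ i : Fin (k + 1), Fin (if (i : ℕ) < k then 1 else n - k) :=
    ⟨i.castSucc, ⟨0, by simp⟩⟩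
  let y (j : Fin (n - k)) : Σ i : Fin (k + 1), Fin (if (i : ℕ) < k then 1 else n - k) :=
    ⟨Fin.last k, Fin.cast (by simp) j⟩
  have hy : Function.Injective y := by
    intro j j' h
    simpa [y] using h
  have hxx {i j : Fin k} (h : i ≠ j) : (f (x i)).2.1 ≠ (f (x j)).2.1 :=
    (hadj (show (Book k n).Adj (x i) (x j) from fun e => h (Fin.castSucc_injective k e))).2
  have hyx (j : Fin (n - k)) (i : Fin k) :
      (f (y j)).1 = (f (x i)).1 ∧ (f (y j)).2.1 ≠ (f (x i)).2.1 :=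
    hadj (show (Book k n).Adj (y j) (x i) from (Fin.castSucc_lt_last i).ne')
  let B : Finset (Fin m) := Finset.univ.image fun i => (f (x i)).2.1
  have hB : B.card = k := by
    rw [Finset.card_image_of_injective _ fun i j h => by_contra fun hne => hxx hne h]
    simp
  have hle : (Finset.univ : Finset (Fin (n - k))).card ≤
      (Bᶜ ×ˢ (Finset.univ : Finset (Fin s))).card := by
    refine Finset.card_le_card_of_injOn (fun j => (f (y j)).2) ?_ ?_
    · intro j _
      simp only [B, Finset.coe_product, Set.mem_prod, Finset.mem_coe, Finset.mem_compl,
        Finset.mem_image, Finset.mem_univ, true_and, and_true, not_exists]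
      exact fun i h => (hyx j i).2 h.symm
    · intro j _ j' _ h
      exact hy (hf (Prod.ext ((hyx j ⟨0, hk⟩).1.trans (hyx j' ⟨0, hk⟩).1.symm) h))
  rw [Finset.card_product, Finset.card_compl, hB] at hle
  simp only [Finset.card_univ, Fintype.card_fin] at hle
  omega

/-- The lower-bound construction (2.1): for `k, p ≥ 2`, `n ≥ k+2` and positive
`a₂ ≤ ⋯ ≤ a_p`, we have
`r(K_p(1,a₂,…,a_p), B_{k,n}) ≥ (p-1)(⌊(n-k-1)/a₂⌋ + k)a₂ + 1`, and consequently
`r(K_p(1,a₂,…,a_p), B_{k,n}) ≥ (p-1)(n-1) + (p-1)(k-1)(a₂-1) + 1`. -/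
theorem ramsey_book_lower_construction (k p : ℕ) (hk : 2 ≤ k) (hp : 2 ≤ p)
    (n : ℕ) (hn : k + 2 ≤ n) (a : Fin p → ℕ) (ha1 : a ⟨0, by omega⟩ = 1)
    (hpos : ∀ i, 1 ≤ a i) (hmono : Monotone a) :
    (p - 1) * ((n - k - 1) / a ⟨1, by omega⟩ + k) * a ⟨1, by omega⟩ + 1 ≤
      ramseyNumber (KMulti a) (Book k n) ∧
    (p - 1) * (n - 1) + (p - 1) * (k - 1) * (a ⟨1, by omega⟩ - 1) + 1 ≤
      ramseyNumber (KMulti a) (Book k n) := by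
  obtain ⟨q, rfl⟩ : ∃ q, p = q + 1 := ⟨p - 1, by omega⟩
  set s := a ⟨1, by omega⟩
  have hs1 : 1 ≤ s := hpos _
  have hdiv : (n - k - 1) / s * s ≤ n - k - 1 := Nat.div_mul_le_self _ _
  have hfirst : q * ((n - k - 1) / s + k) * s + 1 ≤ ramseyNumber (KMulti a) (Book k n) := by
    have hlt := card_lt_ramseyNumber (joinCliqueUnion q ((n - k - 1) / s + k) s)
      (not_hasCopy_joinCliqueUnion hs1 a (hpos _) fun i hi => hmono
        (Fin.le_def.mpr (Nat.one_le_iff_ne_zero.mpr (Fin.val_ne_zero_iff.mpr hi))))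
      (not_hasCopy_compl_joinCliqueUnion (k := k) (n := n) (by omega)
        (by rw [Nat.add_sub_cancel]; omega))
    simpa [← mul_assoc] using hlt
  rw [Nat.add_sub_cancel]
  refine ⟨hfirst, le_trans ?_ hfirst⟩
  have hlt : n - k - 1 < s * ((n - k - 1) / s + 1) := Nat.lt_mul_div_succ _ hs1
  generalize (n - k - 1) / s = d at hlt
  obtain ⟨t, ht⟩ : ∃ t, s = t + 1 := ⟨s - 1, by omega⟩
  obtain ⟨l, rfl⟩ : ∃ l, k = l + 1 := ⟨k - 1, by omega⟩
  rw [ht] at hlt ⊢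
  simp only [Nat.add_sub_cancel]
  rw [mul_assoc, mul_assoc, ← mul_add]
  refine Nat.add_le_add_right (Nat.mul_le_mul_left q ?_) 1
  have hn' : n ≤ (t + 1) * (d + 1) + (l + 1) := by omega
  have : (d + (l + 1)) * (t + 1) + 1 = (t + 1) * (d + 1) + (l + 1) + l * t := by ring
  omega
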